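/- arXiv:cond-mat/9411071 — 2 statements merged into one kernel-verified Lean document; each statement's English description precedes it below -/
import Mathlib

section
/- Let B : Fin 64 → M₈(ℂ) be a family of Hermitian 8×8 complex matrices satisfying Tr(Bₘ·Bₘ') = 8 if m = m' and 0 otherwise, (Bₘ)² = I₈ for every m, and B₀ = −I₈. Let f be an 8×8 Hermitian matrix with f² = f and Tr f = 4 (a rank-4 orthogonal projection), and define αₘ = (1/8)·Tr(Bₘ·f). Then each αₘ is real and: (i) α₀ = −1/2; (ii) Σₘ αₘ² = 1/2; (iii) the matrix A = Σ_{m ≠ m', m ≠ 0, m' ≠ 0} αₘ·αₘ'·(Bₘ·Bₘ' + Bₘ'·Bₘ) is the zero matrix. (This is the paper's Lemma 1: the restrictions on the mean-field expectation values ⟨α_k^m⟩.) -/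
open Matrix in
/-- A family of `n²` square matrices of order `n` that is orthogonal for the trace form, with common
nonzero norm `d`, expands every matrix. -/
theorem Matrix.eq_sum_trace_smul_of_trace_mul_eq_ite {K n ι : Type*} [Field K] [Fintype n]
    [DecidableEq n] [Fintype ι] [DecidableEq ι] {d : K} (hd : d ≠ 0)
    (hcard : Fintype.card ι = Fintype.card n * Fintype.card n) (B : ι → Matrix n n K)
    (hB : ∀ i j, trace (B i * B j) = if i = j then d else 0) (f : Matrix n n K) :
    f = ∑ i, (d⁻¹ * trace (B i * f)) • B i := by
  have htr (c : ι → K) (k : ι) : trace (B k * ∑ i, c i • B i) = d * c k := by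
    simp [Finset.mul_sum, trace_sum, hB, mul_comm]
  have hli : LinearIndependent K B := by
    rw [Fintype.linearIndependent_iff]
    intro c hc k
    have h := htr c k
    rw [hc, mul_zero, trace_zero] at h
    exact (mul_eq_zero.mp h.symm).resolve_left hd
  have hspan : f ∈ Submodule.span K (Set.range B) := by
    rw [hli.span_eq_top_of_card_eq_finrank' (by simp [hcard, Module.finrank_matrix])]
    trivial
  obtain ⟨c, rfl⟩ := (Submodule.mem_span_range_iff_exists_fun K).mp hspan
  simp_rw [htr, inv_mul_cancel_left₀ hd]

open Matrix in
/-- The trace of a product of two Hermitian matrices is real. -/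
theorem Matrix.IsHermitian.im_trace_mul {n : Type*} [Fintype n] {A B : Matrix n n ℂ}
    (hA : A.IsHermitian) (hB : B.IsHermitian) : (trace (A * B)).im = 0 := by
  rw [← Complex.conj_eq_iff_im, starRingEnd_apply, ← trace_conjTranspose, conjTranspose_mul,
    hA.eq, hB.eq, trace_mul_comm]

open Matrix in
/-- The off-diagonal anticommutator part of the square of a linear combination of involutions. -/
theorem Matrix.sum_smul_anticommutator_offDiag {K n ι : Type*} [Field K] [Fintype n]
    [DecidableEq n] [Fintype ι] [DecidableEq ι] (B : ι → Matrix n n K)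
    (hB : ∀ i, B i * B i = 1) (b : ι → K) :
    (∑ i, ∑ j, if i ≠ j then (b i * b j) • (B i * B j + B j * B i) else 0) =
      (2 : K) • ((∑ i, b i • B i) * (∑ i, b i • B i) - (∑ i, b i ^ 2) • 1) := by
  have h (i j : ι) : (if i ≠ j then (b i * b j) • (B i * B j + B j * B i) else 0) =
      (b i • B i) * (b j • B j) + (b j • B j) * (b i • B i)
        - if i = j then (2 * b i ^ 2) • (1 : Matrix n n K) else 0 := by
    by_cases hij : i = j
    · subst hij
      simp only [ne_eq, not_true_eq_false, if_false, if_true, smul_mul_smul_comm, hB]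
      module
    · simp only [ne_eq, hij, not_false_eq_true, if_true, if_false, smul_mul_smul_comm]
      module
  simp_rw [h, Finset.sum_sub_distrib, Finset.sum_add_distrib]
  rw [Finset.sum_comm (f := fun i j => (b j • B j) * (b i • B i))]
  simp only [Finset.sum_mul_sum, Finset.sum_ite_eq, Finset.mem_univ, if_true, ← Finset.sum_smul,
    ← Finset.mul_sum]
  module


open Matrix in
/-- Paper's Lemma 1: restrictions on the mean-field expectation values α_m. -/
theorem hubbard_mf_lemma1
    (B : Fin 64 → Matrix (Fin 8) (Fin 8) ℂ)
    (hHerm : ∀ m, (B m).IsHermitian)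
    (hOrtho : ∀ m m', Matrix.trace (B m * B m') = if m = m' then 8 else 0)
    (hSq : ∀ m, B m * B m = 1)
    (hB0 : B 0 = -1)
    (f : Matrix (Fin 8) (Fin 8) ℂ)
    (hfHerm : f.IsHermitian)
    (hfProj : f * f = f)
    (hfTr : Matrix.trace f = 4)
    (α : Fin 64 → ℂ)
    (hα : ∀ m, α m = (1 / 8 : ℂ) * Matrix.trace (B m * f)) :
    (∀ m, (α m).im = 0) ∧
    α 0 = -(1 / 2) ∧
    (∑ m, (α m) ^ 2) = 1 / 2 ∧
    (∑ m, ∑ m', if m ≠ m' ∧ m ≠ 0 ∧ m' ≠ 0 then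
        (α m * α m') • (B m * B m' + B m' * B m) else 0) = 0 := by
  have hexp : f = ∑ m, α m • B m := by
    have h := Matrix.eq_sum_trace_smul_of_trace_mul_eq_ite (d := (8 : ℂ)) (by norm_num) (by simp)
      B hOrtho f
    simpa only [hα, one_div] using h
  have hα0 : α 0 = -(1 / 2) := by
    rw [hα, hB0, neg_one_mul, trace_neg, hfTr]
    norm_num
  have hsum : (∑ m, α m ^ 2) = 1 / 2 := by
    have h : trace (f * f) = ∑ m, α m * trace (B m * f) := by
      conv_lhs => enter [1, 1]; rw [hexp]
      simp [Finset.sum_mul, trace_sum]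
    have h8 (m) : α m * trace (B m * f) = 8 * α m ^ 2 := by
      rw [hα]
      ring
    simp_rw [hfProj, hfTr, h8, ← Finset.mul_sum] at h
    linear_combination -h / 8
  refine ⟨fun m => ?_, hα0, hsum, ?_⟩
  · rw [hα, Complex.mul_im, (hHerm m).im_trace_mul hfHerm]
    simp
  · set b : Fin 64 → ℂ := Function.update α 0 0 with hb
    have hoff := Matrix.sum_smul_anticommutator_offDiag B hSq b
    have hbB : ∑ m, b m • B m = f - (1 / 2 : ℂ) • 1 := by
      rw [hexp, ← Finset.add_sum_erase _ (fun m => α m • B m) (Finset.mem_univ 0),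
        ← Finset.add_sum_erase _ (fun m => b m • B m) (Finset.mem_univ 0),
        Finset.sum_congr rfl fun m hm => by
          rw [hb, Function.update_of_ne (Finset.ne_of_mem_erase hm)]]
      simp only [hb, Function.update_self, hα0, hB0]
      module
    have hbsq : ∑ m, b m ^ 2 = 1 / 4 := by
      rw [← Finset.add_sum_erase _ _ (Finset.mem_univ 0), hα0] at hsum
      rw [← Finset.add_sum_erase _ _ (Finset.mem_univ 0),
        Finset.sum_congr rfl fun m hm => by
          rw [hb, Function.update_of_ne (Finset.ne_of_mem_erase hm)]]
      simp only [hb, Function.update_self]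
      linear_combination hsum
    have hsq : (f - (1 / 2 : ℂ) • 1) * (f - (1 / 2 : ℂ) • 1) =
        (1 / 4 : ℂ) • (1 : Matrix (Fin 8) (Fin 8) ℂ) := by
      simp only [sub_mul, mul_sub, hfProj, smul_mul_assoc, mul_smul_comm, one_mul, mul_one]
      module
    rw [hbB, hbsq, hsq, sub_self, smul_zero] at hoff
    refine Eq.trans ?_ hoff
    refine Finset.sum_congr rfl fun m _ => Finset.sum_congr rfl fun m' _ => ?_
    by_cases hm : m = 0
    · simp [hb, hm]
    by_cases hm' : m' = 0
    · simp [hb, hm']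
    simp [hb, hm, hm']
end

section
/- Define the Pauli matrices σ₁ = [[0,1],[1,0]], σ₂ = [[0,−i],[i,0]], σ₃ = [[1,0],[0,−1]]; the 4×4 Dirac matrices γ₀ = [[I₂,0],[0,−I₂]] and γⱼ = [[0,σⱼ],[−σⱼ,0]] for j = 1,2,3; the 8×8 matrices β₀ = [[γ₀,0],[0,−γ₀]] and βⱼ = [[γⱼ,0],[0,γⱼ*]] for j = 1,2,3 (where * denotes entrywise complex conjugation, not adjoint); the 8×8 matrix Z whose only nonzero entries are Z₁₁ = Z₃₃ = Z₅₅ = Z₇₇ = Z₂₈ = Z₄₆ = Z₆₄ = Z₈₂ = 1; and β_{j+3} = i·Z·β₀·βⱼ·Z for j = 1,2,3. Then the seven matrices β₀, β₁, …, β₆ form a Clifford algebra: β_A·β_B + β_B·β_A = 2·g_{AB}·I₈ for all 0 ≤ A, B ≤ 6, where g₀₀ = 1, g_{nn} = −1 for n = 1, …, 6, and g_{AB} = 0 for A ≠ B. -/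
namespace HubbardClifford

open Matrix

/-- The three Pauli matrices. -/
def pauli : Fin 3 → Matrix (Fin 2) (Fin 2) ℂ :=
  ![!![0, 1; 1, 0], !![0, -Complex.I; Complex.I, 0], !![1, 0; 0, -1]]

/-- A 4×4 matrix built from 2×2 blocks. -/
def blk4 (A B C D : Matrix (Fin 2) (Fin 2) ℂ) : Matrix (Fin 4) (Fin 4) ℂ :=
  Matrix.reindex finSumFinEquiv finSumFinEquiv (Matrix.fromBlocks A B C D)

/-- An 8×8 matrix built from 4×4 blocks. -/
def blk8 (A B C D : Matrix (Fin 4) (Fin 4) ℂ) : Matrix (Fin 8) (Fin 8) ℂ :=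
  Matrix.reindex finSumFinEquiv finSumFinEquiv (Matrix.fromBlocks A B C D)

/-- The Dirac matrix γ₀ = [[I₂,0],[0,−I₂]]. -/
def gamma0 : Matrix (Fin 4) (Fin 4) ℂ := blk4 1 0 0 (-1)

/-- The Dirac matrices γⱼ = [[0,σⱼ],[−σⱼ,0]] for j = 1,2,3. -/
def gamma : Fin 3 → Matrix (Fin 4) (Fin 4) ℂ :=
  fun j => blk4 0 (pauli j) (-(pauli j)) 0

/-- β₀ = [[γ₀,0],[0,−γ₀]]. -/
def beta0 : Matrix (Fin 8) (Fin 8) ℂ := blk8 gamma0 0 0 (-gamma0)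

/-- βⱼ = [[γⱼ,0],[0,γⱼ*]] for j = 1,2,3, where * is entrywise conjugation. -/
def betaSmall : Fin 3 → Matrix (Fin 8) (Fin 8) ℂ :=
  fun j => blk8 (gamma j) 0 0 ((gamma j).map (starRingEnd ℂ))

/-- The Shiba matrix Z (with 1-indexed nonzero entries
Z₁₁ = Z₃₃ = Z₅₅ = Z₇₇ = Z₂₈ = Z₄₆ = Z₆₄ = Z₈₂ = 1). -/
def Zmat : Matrix (Fin 8) (Fin 8) ℂ :=
  !![1, 0, 0, 0, 0, 0, 0, 0;
     0, 0, 0, 0, 0, 0, 0, 1;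
     0, 0, 1, 0, 0, 0, 0, 0;
     0, 0, 0, 0, 0, 1, 0, 0;
     0, 0, 0, 0, 1, 0, 0, 0;
     0, 0, 0, 1, 0, 0, 0, 0;
     0, 0, 0, 0, 0, 0, 1, 0;
     0, 1, 0, 0, 0, 0, 0, 0]

/-- The seven matrices β₀, β₁, …, β₆, with β_{j+3} = i·Z·β₀·βⱼ·Z. -/
noncomputable def betaFamily : Fin 7 → Matrix (Fin 8) (Fin 8) ℂ :=
  ![beta0, betaSmall 0, betaSmall 1, betaSmall 2,
    Complex.I • (Zmat * beta0 * betaSmall 0 * Zmat),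
    Complex.I • (Zmat * beta0 * betaSmall 1 * Zmat),
    Complex.I • (Zmat * beta0 * betaSmall 2 * Zmat)]

/-- The metric g: g₀₀ = 1, g_{nn} = −1 for n = 1,…,6, g_{AB} = 0 for A ≠ B. -/
def g : Fin 7 → Fin 7 → ℂ :=
  fun A B => if A = B then (if A = 0 then 1 else -1) else 0

/-- The matrix whose row `a` has the single nonzero entry `I ^ e a`, in column `p a`. -/
def phaseMatrix {n : ℕ} (p : Fin n → Fin n) (e : Fin n → ℕ) : Matrix (Fin n) (Fin n) ℂ :=
  Matrix.of fun a b => if p a = b then Complex.I ^ e a else 0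

lemma phaseMatrix_mul {n : ℕ} (p q : Fin n → Fin n) (e f : Fin n → ℕ) :
    phaseMatrix p e * phaseMatrix q f =
      phaseMatrix (fun a => q (p a)) (fun a => e a + f (p a)) := by
  ext a b
  simp only [phaseMatrix, Matrix.mul_apply, Matrix.of_apply, ite_mul, zero_mul]
  simp [pow_add]

lemma I_smul_phaseMatrix {n : ℕ} (p : Fin n → Fin n) (e : Fin n → ℕ) :
    Complex.I • phaseMatrix p e = phaseMatrix p (fun a => e a + 1) := by
  ext a b
  simp [phaseMatrix, pow_succ']

lemma I_pow_congr {k l : ℕ} (h : k % 4 = l % 4) : Complex.I ^ k = Complex.I ^ l := by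
  rw [Complex.I_pow_eq_pow_mod k, Complex.I_pow_eq_pow_mod l, h]

lemma phaseMatrix_add_eq_zero {n : ℕ} {p q : Fin n → Fin n} {e f : Fin n → ℕ}
    (hpq : ∀ a, p a = q a) (hef : ∀ a, e a % 4 = (f a + 2) % 4) :
    phaseMatrix p e + phaseMatrix q f = 0 := by
  ext a b
  simp only [phaseMatrix, Matrix.add_apply, Matrix.of_apply, hpq a, I_pow_congr (hef a)]
  split_ifs <;> simp [pow_add]

lemma phaseMatrix_eq_smul_one {n : ℕ} {p : Fin n → Fin n} {e : Fin n → ℕ} {k : ℕ}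
    (hp : ∀ a, p a = a) (he : ∀ a, e a % 4 = k % 4) :
    phaseMatrix p e = Complex.I ^ k • (1 : Matrix (Fin n) (Fin n) ℂ) := by
  ext a b
  simp [phaseMatrix, Matrix.one_apply, hp a, I_pow_congr (he a)]

lemma blk4_eq (A B C D : Matrix (Fin 2) (Fin 2) ℂ) :
    blk4 A B C D =
    !![A 0 0, A 0 1, B 0 0, B 0 1;
       A 1 0, A 1 1, B 1 0, B 1 1;
       C 0 0, C 0 1, D 0 0, D 0 1;
       C 1 0, C 1 1, D 1 0, D 1 1] := by
  ext a b
  fin_cases a <;> fin_cases b <;> rfl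

lemma blk8_eq (A B C D : Matrix (Fin 4) (Fin 4) ℂ) :
    blk8 A B C D =
    !![A 0 0, A 0 1, A 0 2, A 0 3, B 0 0, B 0 1, B 0 2, B 0 3;
       A 1 0, A 1 1, A 1 2, A 1 3, B 1 0, B 1 1, B 1 2, B 1 3;
       A 2 0, A 2 1, A 2 2, A 2 3, B 2 0, B 2 1, B 2 2, B 2 3;
       A 3 0, A 3 1, A 3 2, A 3 3, B 3 0, B 3 1, B 3 2, B 3 3;
       C 0 0, C 0 1, C 0 2, C 0 3, D 0 0, D 0 1, D 0 2, D 0 3;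
       C 1 0, C 1 1, C 1 2, C 1 3, D 1 0, D 1 1, D 1 2, D 1 3;
       C 2 0, C 2 1, C 2 2, C 2 3, D 2 0, D 2 1, D 2 2, D 2 3;
       C 3 0, C 3 1, C 3 2, C 3 3, D 3 0, D 3 1, D 3 2, D 3 3] := by
  ext a b
  fin_cases a <;> fin_cases b <;> rfl

/-- The column of the nonzero entry in each row of `Zmat`. -/
def zmatCol : Fin 8 → Fin 8 := ![0, 7, 2, 5, 4, 3, 6, 1]

lemma Zmat_eq : Zmat = phaseMatrix zmatCol 0 := by
  ext a b
  fin_cases a <;> fin_cases b <;> simp [Zmat, phaseMatrix, zmatCol]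

/-- The powers of `I` on the diagonal of `beta0`. -/
def beta0Exp : Fin 8 → ℕ := ![0, 0, 2, 2, 2, 2, 0, 0]

lemma beta0_eq : beta0 = phaseMatrix id beta0Exp := by
  ext a b
  fin_cases a <;> fin_cases b <;>
    simp [beta0, gamma0, blk4_eq, blk8_eq, phaseMatrix, beta0Exp]

/-- The column of the nonzero entry in each row of `betaSmall j`. -/
def betaSmallCol : Fin 3 → Fin 8 → Fin 8 :=
  ![![3, 2, 1, 0, 7, 6, 5, 4], ![3, 2, 1, 0, 7, 6, 5, 4], ![2, 3, 0, 1, 6, 7, 4, 5]]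

/-- The power of `I` occurring in each row of `betaSmall j`. -/
def betaSmallExp : Fin 3 → Fin 8 → ℕ :=
  ![![0, 0, 2, 2, 0, 0, 2, 2], ![3, 1, 1, 3, 1, 3, 3, 1], ![0, 2, 2, 0, 0, 2, 2, 0]]

set_option maxHeartbeats 1600000 in
lemma betaSmall_eq (j : Fin 3) :
    betaSmall j = phaseMatrix (betaSmallCol j) (betaSmallExp j) := by
  ext a b
  fin_cases j <;> fin_cases a <;> fin_cases b <;>
    simp [betaSmall, gamma, pauli, blk4_eq, blk8_eq, phaseMatrix, betaSmallCol, betaSmallExp,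
      Complex.I_pow_three]

/-- The column of the nonzero entry in each row of `betaFamily A`. -/
def betaCol : Fin 7 → Fin 8 → Fin 8 :=
  ![id, betaSmallCol 0, betaSmallCol 1, betaSmallCol 2,
    fun a => zmatCol (betaSmallCol 0 (zmatCol a)),
    fun a => zmatCol (betaSmallCol 1 (zmatCol a)),
    fun a => zmatCol (betaSmallCol 2 (zmatCol a))]

/-- The power of `I` occurring in each row of `betaFamily A`. -/
def betaExp : Fin 7 → Fin 8 → ℕ :=
  ![beta0Exp, betaSmallExp 0, betaSmallExp 1, betaSmallExp 2,
    fun a => beta0Exp (zmatCol a) + betaSmallExp 0 (zmatCol a) + 1,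
    fun a => beta0Exp (zmatCol a) + betaSmallExp 1 (zmatCol a) + 1,
    fun a => beta0Exp (zmatCol a) + betaSmallExp 2 (zmatCol a) + 1]

lemma betaFamily_eq (A : Fin 7) : betaFamily A = phaseMatrix (betaCol A) (betaExp A) := by
  fin_cases A <;>
    simp [betaFamily, betaCol, betaExp, beta0_eq, betaSmall_eq, Zmat_eq, phaseMatrix_mul,
      I_smul_phaseMatrix]

lemma betaFamily_mul_self (A : Fin 7) : betaFamily A * betaFamily A = g A A • 1 := by
  have hcol : ∀ A a, betaCol A (betaCol A a) = a := by decide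
  have hexp : ∀ A a, (betaExp A a + betaExp A (betaCol A a)) % 4 =
      (if A = 0 then 0 else 2) % 4 := by decide
  rw [betaFamily_eq, phaseMatrix_mul, phaseMatrix_eq_smul_one (hcol A) (hexp A)]
  split_ifs with h <;> simp [g, h]

lemma betaFamily_anticomm {A B : Fin 7} (h : A ≠ B) :
    betaFamily A * betaFamily B + betaFamily B * betaFamily A = 0 := by
  have hcol : ∀ A B a, betaCol B (betaCol A a) = betaCol A (betaCol B a) := by decide
  have hexp : ∀ A B, A ≠ B → ∀ a, (betaExp A a + betaExp B (betaCol A a)) % 4 =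
      (betaExp B a + betaExp A (betaCol B a) + 2) % 4 := by decide
  rw [betaFamily_eq, betaFamily_eq, phaseMatrix_mul, phaseMatrix_mul]
  exact phaseMatrix_add_eq_zero (hcol A B) (hexp A B h)

/-- The seven matrices β₀, …, β₆ form a Clifford algebra:
β_A β_B + β_B β_A = 2 g_{AB} I₈. -/
theorem betaFamily_clifford :
    ∀ A B : Fin 7,
      betaFamily A * betaFamily B + betaFamily B * betaFamily A =
        (2 * g A B) • (1 : Matrix (Fin 8) (Fin 8) ℂ) := by
  intro A B
  by_cases h : A = B
  · subst h
    rw [betaFamily_mul_self, ← two_smul ℂ, smul_smul]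
  · rw [betaFamily_anticomm h]
    simp [g, h]

end HubbardClifford
end
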